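/- arXiv:2308.02973 — 4 statements merged into one kernel-verified Lean document; each statement's English description precedes it below -/
import Mathlib

section
/- Consider any protocol trace starting from the empty window. If the send values of the trace are pairwise distinct (the list of send values is duplicate-free), then the window obtained after processing the whole trace is a sublist (in the Lean List.Sublist sense, order-preserving) of the list of send values of the trace, and the window is duplicate-free. -/
/-- Remove items from the head of `l` up to and including the first occurrence
of `c`; if `c ∉ l`, the result is `[]`. -/
def removeThrough {α : Type*} [DecidableEq α] (c : α) (l : List α) : List α :=
  (l.dropWhile (fun x => decide (x ≠ c))).tail

/-- An operation in a protocol trace: the relying party sends a challenge hash,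
or an authenticator responds with a stored challenge hash. -/
inductive Op (α : Type*) where
  | send (c : α)
  | respond (c : α)

/-- One step of the relying party's window update. A `send c` appends `c` to the
window; a `respond c` succeeds iff `c` is in the window, in which case the window
is updated to `removeThrough c`; a failed respond leaves the window unchanged. -/
def step {α : Type*} [DecidableEq α] (w : List α) (o : Op α) : List α :=
  match o with
  | .send c => w ++ [c]
  | .respond c => if c ∈ w then removeThrough c w else w

/-- The window after processing a whole trace from initial window `init`. -/
def window {α : Type*} [DecidableEq α] (init : List α) (t : List (Op α)) : List α :=
  t.foldl step init

/-- The list of values of the `send` operations of a trace, in order. -/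
def sends {α : Type*} : List (Op α) → List α :=
  List.filterMap (fun o => match o with | .send c => some c | .respond _ => none)

theorem removeThrough_sublist {α : Type*} [DecidableEq α] (c : α) (l : List α) :
    (removeThrough c l).Sublist l :=
  (List.tail_sublist _).trans (List.dropWhile_sublist _)

theorem window_sublist_append_sends {α : Type*} [DecidableEq α] (w : List α)
    (t : List (Op α)) : (window w t).Sublist (w ++ sends t) := by
  induction t generalizing w with
  | nil => simp [window, sends]
  | cons o t ih =>
    have h := ih (step w o)
    cases o with
    | send c => simpa [window, sends, step] using h
    | respond c =>
      have hs : (step w (.respond c)).Sublist w := by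
        simp only [step]
        split_ifs
        · exact removeThrough_sublist c w
        · exact .refl w
      exact h.trans (hs.append_right (sends t))

theorem stmt_2 {α : Type*} [DecidableEq α] (t : List (Op α))
    (hnd : (sends t).Nodup) :
    (window [] t).Sublist (sends t) ∧ (window [] t).Nodup := by
  have h := window_sublist_append_sends [] t
  exact ⟨h, hnd.sublist h⟩
end

section
/- Consider any protocol trace starting from the empty window whose send values are pairwise distinct. Then for every challenge hash c : α, at most one respond c operation in the trace succeeds. That is, in the hash-based clone detection algorithm with non-repeating challenges, each challenge hash can be used to authenticate successfully at most once. -/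
theorem notMem_removeThrough_of_nodup {α : Type*} [DecidableEq α] (c : α) {l : List α}
    (h : l.Nodup) : c ∉ removeThrough c l := by
  induction l with
  | nil => simp [removeThrough]
  | cons a l ih =>
    rw [List.nodup_cons] at h
    by_cases hac : a = c
    · subst hac
      simpa [removeThrough] using h.1
    · simpa [removeThrough, List.dropWhile_cons, hac] using ih h.2

theorem window_sublist {α : Type*} [DecidableEq α] (t : List (Op α)) (w : List α) :
    (window w t).Sublist (w ++ sends t) := by
  induction t generalizing w with
  | nil => simp [window, sends]
  | cons o t ih =>
    have h : (window w (o :: t)).Sublist (step w o ++ sends t) := ih (step w o)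
    cases o with
    | send c => simpa [step, sends] using h
    | respond c =>
      refine h.trans (List.Sublist.append ?_ (List.Sublist.refl _))
      unfold step
      dsimp only
      split_ifs
      · exact removeThrough_sublist c w
      · exact List.Sublist.refl _

theorem window_append {α : Type*} [DecidableEq α] (w : List α) (s t : List (Op α)) :
    window w (s ++ t) = window (window w s) t :=
  List.foldl_append

theorem sends_append {α : Type*} (s t : List (Op α)) :
    sends (s ++ t) = sends s ++ sends t :=
  List.filterMap_append

theorem sends_sublist {α : Type*} {s t : List (Op α)} (h : s.Sublist t) :
    (sends s).Sublist (sends t) :=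
  h.filterMap _

/-- With non-repeating challenges, each challenge hash can be used to
authenticate successfully at most once: no two distinct `respond c`
operations in the trace both succeed. -/
theorem stmt_3 {α : Type*} [DecidableEq α] (t : List (Op α))
    (hnd : (sends t).Nodup) (c : α) :
    ∀ i j : ℕ, i < j →
      t[i]? = some (Op.respond c) → t[j]? = some (Op.respond c) →
      ¬(c ∈ window [] (t.take i) ∧ c ∈ window [] (t.take j)) := by
  rintro i j hij hi - ⟨hci, hcj⟩
  obtain ⟨m, hm⟩ : ∃ m, t.take j = t.take i ++ Op.respond c :: m := by
    have hpre : t.take (i + 1) <+: t.take j := List.take_prefix_take_left hij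
    obtain ⟨m, hm⟩ := hpre
    exact ⟨m, by rw [← hm, List.take_add_one, hi]; simp⟩
  have hsend : (sends (t.take i) ++ sends m).Nodup := by
    have h := hnd.sublist (sends_sublist (List.take_sublist j t))
    rwa [hm, sends_append] at h
  have hsub : (window [] (t.take i)).Sublist (sends (t.take i)) := window_sublist _ []
  rw [hm, window_append] at hcj
  have hmem : c ∈ window (removeThrough c (window [] (t.take i))) m := by
    have h : step (window [] (t.take i)) (Op.respond c) = _ := if_pos hci
    rw [← h]
    exact hcj
  rcases List.mem_append.1 ((window_sublist _ _).subset hmem) with h | h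
  · exact notMem_removeThrough_of_nodup c (hsend.of_append_left.sublist hsub) h
  · exact List.disjoint_of_nodup_append hsend (hsub.subset hci) h
end

section
/- (No false positives under lost requests or lost responses.) Let c : ℕ → α be an injective function assigning challenge hashes to indices, and let m < n be natural numbers. Suppose the relying party's window is the list of challenge hashes with indices m+1 through n, i.e., window = (List.range' (m+1) (n-m)).map c, modeling that the challenge of index m was the last one matched and challenges m+1, …, n have since been sent. If the hardware security key's stored challenge hash is c j for some index j with m < j ≤ n (the most recent challenge it actually received, even if some intervening requests or responses were lost), then c j ∈ window, so the authentication succeeds, and the updated window removeThrough (c j) window equals (List.range' (j+1) (n-j)).map c, the list of challenge hashes with indices j+1 through n. -/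
theorem removeThrough_append_cons {α : Type*} [DecidableEq α] {c : α} {l₁ : List α}
    (h : c ∉ l₁) (l₂ : List α) : removeThrough c (l₁ ++ c :: l₂) = l₂ := by
  have h' : ∀ x ∈ l₁, decide (x ≠ c) = true := fun x hx =>
    decide_eq_true fun hxc => h (hxc ▸ hx)
  rw [removeThrough, List.dropWhile_append_of_pos h']
  simp

theorem range'_eq_append_cons {m j n : ℕ} (hmj : m < j) (hjn : j ≤ n) :
    List.range' (m + 1) (n - m) =
      List.range' (m + 1) (j - m - 1) ++ j :: List.range' (j + 1) (n - j) := by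
  rw [← List.range'_succ]
  have h := List.range'_append_1 (s := m + 1) (m := j - m - 1) (n := n - j + 1)
  rw [show m + 1 + (j - m - 1) = j by omega,
    show j - m - 1 + (n - j + 1) = n - m by omega] at h
  exact h.symm

/-- No false positives under lost requests or lost responses: if the window is
the list of challenge hashes of indices `m+1` through `n` and the key stores the
hash of index `j` with `m < j ≤ n`, then the authentication succeeds and the
updated window is the list of challenge hashes of indices `j+1` through `n`. -/
theorem stmt_7 {α : Type*} [DecidableEq α] (c : ℕ → α)
    (hc : Function.Injective c) (m n : ℕ) (hmn : m < n) (j : ℕ)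
    (hmj : m < j) (hjn : j ≤ n) :
    c j ∈ (List.range' (m + 1) (n - m)).map c ∧
      removeThrough (c j) ((List.range' (m + 1) (n - m)).map c) =
        (List.range' (j + 1) (n - j)).map c := by
  rw [range'_eq_append_cons hmj hjn, List.map_append, List.map_cons]
  refine ⟨by simp, removeThrough_append_cons ?_ _⟩
  rw [List.mem_map_of_injective hc, List.mem_range'_1]
  omega
end

section
/- (Detection of responses with unseen challenge hashes.) Consider any protocol trace starting from the empty window, and let h : α be a value that is not among the send values of the trace. Then h is not a member of the window computed after processing the trace; consequently, any respond h operation appended at that point fails, i.e., an authentication response carrying a challenge hash never issued by the relying party is always rejected (clone detection). -/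
theorem mem_of_mem_removeThrough {α : Type*} [DecidableEq α] {a c : α} {l : List α}
    (ha : a ∈ removeThrough c l) : a ∈ l :=
  (List.dropWhile_sublist _).subset (List.mem_of_mem_tail ha)

/-- Every element of the window was either there initially or sent along the trace. -/
theorem mem_or_mem_sends_of_mem_window {α : Type*} [DecidableEq α] {a : α} {init : List α}
    {t : List (Op α)} (ha : a ∈ window init t) : a ∈ init ∨ a ∈ sends t := by
  induction t generalizing init with
  | nil => exact Or.inl ha
  | cons o t ih =>
    cases o with
    | send c =>
      have h := ih (init := init ++ [c]) ha
      simp only [sends, List.filterMap_cons, List.mem_append, List.mem_cons,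
        List.not_mem_nil, or_false] at h ⊢
      tauto
    | respond c =>
      have h := ih (init := step init (Op.respond c)) ha
      refine h.imp (fun hs => ?_) id
      simp only [step] at hs
      split_ifs at hs
      · exact mem_of_mem_removeThrough hs
      · exact hs

/-- Detection of responses with unseen challenge hashes: if `h` is never sent
by the relying party, it is not in the window after any trace from the empty
window, so a `respond h` fails (and leaves the window unchanged). -/
theorem stmt_8 {α : Type*} [DecidableEq α] (t : List (Op α)) (h : α)
    (hns : h ∉ sends t) :
    h ∉ window [] t ∧ step (window [] t) (Op.respond h) = window [] t := by
  have hw : h ∉ window [] t := fun hm =>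
    (mem_or_mem_sends_of_mem_window hm).elim List.not_mem_nil hns
  exact ⟨hw, if_neg hw⟩
end
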